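/- Let k be an algebraically closed field of characteristic zero and let n be an odd positive integer. Let A' = k_{−1}[u^{±1}, v^{±1}] and A'' = A'[(u^{2n} − v^{2n})^{−1}], and let the dihedral group D_n = ⟨g, h : g^n = h² = (hg)² = e⟩ act by g·u = ωu, g·v = ω^{−1}v (ω a primitive nth root of unity), h·u = v, h·v = u. Then the skew group ring T'' = A'' # D_n is an Azumaya algebra. -/

import Mathlib

/-- `T` together with `ι : A →+* T` and `j : G → T` is the skew group ring `A # G`
for the action of the finite group `G` on `A`. -/
structure IsSkewGroupRing (A : Type*) [Ring A] (G : Type*) [Group G] [Fintype G]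
    [MulSemiringAction G A] (T : Type*) [Ring T] (ι : A →+* T) (j : G → T) : Prop where
  injective : Function.Injective ι
  j_one : j 1 = 1
  j_mul : ∀ g h : G, j g * j h = j (g * h)
  comm : ∀ (g : G) (a : A), j g * ι a = ι (g • a) * j g
  basis : ∀ t : T, ∃! c : G → A, t = ∑ g : G, ι (c g) * j g

/-- The natural map `A ⊗_{Z(A)} Aᵐᵒᵖ →ₗ End_{Z(A)}(A)`, `a ⊗ b ↦ (r ↦ a * r * b)`. -/
noncomputable def azumayaMulMap (A : Type*) [Ring A] :
    TensorProduct (Subring.center A) A Aᵐᵒᵖ →ₗ[Subring.center A]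
      (A →ₗ[Subring.center A] A) :=
  TensorProduct.lift (LinearMap.mk₂ (Subring.center A)
    (fun a b =>
      { toFun := fun r => a * r * b.unop
        map_add' := fun x y => by simp [mul_add, add_mul]
        map_smul' := fun z x => by
          have hz := Subring.mem_center_iff.mp z.2
          show a * ((z : A) * x) * b.unop = (z : A) * (a * x * b.unop)
          simp only [← mul_assoc]
          rw [hz a] })
    (fun a a' b => by ext r; simp [add_mul])
    (fun z a b => by
      ext r
      have hz := Subring.mem_center_iff.mp z.2
      show ((z : A) * a) * r * b.unop = (z : A) * (a * r * b.unop)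
      simp [mul_assoc])
    (fun a b b' => by ext r; simp [mul_add])
    (fun z a b => by
      ext r
      have hz := Subring.mem_center_iff.mp z.2
      show a * r * ((z : A) • b).unop = (z : A) * (a * r * b.unop)
      rw [MulOpposite.unop_smul]
      show a * r * ((z : A) * b.unop) = (z : A) * (a * r * b.unop)
      rw [← mul_assoc, hz (a * r), mul_assoc]))

/-- A ring is an *Azumaya algebra* (over its centre `Z`) if it is a finitely generated
projective `Z`-module and the natural map `A ⊗_Z Aᵐᵒᵖ → End_Z(A)` is bijective. -/
def IsAzumayaAlgebra (A : Type*) [Ring A] : Prop :=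
  Module.Finite (Subring.center A) A ∧ Module.Projective (Subring.center A) A ∧
    Function.Bijective (azumayaMulMap A)

/-- `f : A →+* B` exhibits `B` as the (right) Ore localization of `A` at the
submonoid `S`. -/
structure IsOreLocalization {A B : Type*} [Ring A] [Ring B] (S : Submonoid A)
    (f : A →+* B) : Prop where
  isUnit : ∀ s ∈ S, IsUnit (f s)
  num_den : ∀ b : B, ∃ a : A, ∃ s ∈ S, b * f s = f a
  ker : ∀ a : A, f a = 0 → ∃ s ∈ S, a * s = 0

/-- The relation defining the quantum plane `K_q[u,v]`: `v u = q · u v`. -/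
inductive QuantumRel (K : Type*) [CommRing K] (q : K) :
    FreeAlgebra K (Fin 2) → FreeAlgebra K (Fin 2) → Prop
  | rel : QuantumRel K q (FreeAlgebra.ι K 1 * FreeAlgebra.ι K 0)
      (q • (FreeAlgebra.ι K 0 * FreeAlgebra.ι K 1))

/-- The quantum plane `K_q[u,v] = K⟨u,v⟩/(vu - q·uv)`. -/
abbrev QuantumPlane (K : Type*) [CommRing K] (q : K) := RingQuot (QuantumRel K q)

/-- The generator `u` of the quantum plane. -/
noncomputable def qU (K : Type*) [CommRing K] (q : K) : QuantumPlane K q :=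
  RingQuot.mkAlgHom K (QuantumRel K q) (FreeAlgebra.ι K 0)

/-- The generator `v` of the quantum plane. -/
noncomputable def qV (K : Type*) [CommRing K] (q : K) : QuantumPlane K q :=
  RingQuot.mkAlgHom K (QuantumRel K q) (FreeAlgebra.ι K 1)

/-- A ring has a *central trace* if some map `r ↦ ∑ l, a l * r * b l` takes values in the centre
and admits finite dual systems `s`, `t` recovering every element. -/
def HasCentralTrace (A : Type*) [Ring A] : Prop :=
  ∃ (κ ι : Type) (_ : Fintype κ) (_ : Fintype ι) (a b : κ → A) (s t : ι → A),
    (∀ r, ∑ l, a l * r * b l ∈ Subring.center A) ∧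
      ∀ r, ∑ i, (∑ l, a l * (r * s i) * b l) * t i = r

theorem azumayaMulMap_tmul_apply {A : Type*} [Ring A] (a : A) (b : Aᵐᵒᵖ) (r : A) :
    azumayaMulMap A (a ⊗ₜ[Subring.center A] b) r = a * r * b.unop := rfl

theorem HasCentralTrace.isAzumayaAlgebra {A : Type*} [Ring A] (hA : HasCentralTrace A) :
    IsAzumayaAlgebra A := by
  obtain ⟨κ, ι, _, _, a, b, s, t, hc, hr⟩ := hA
  classical
  let φ : ι → A →ₗ[Subring.center A] Subring.center A := fun i =>
    { toFun := fun r => ⟨∑ l, a l * (r * s i) * b l, hc (r * s i)⟩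
      map_add' := fun x y => by
        ext
        simp [mul_add, add_mul, Finset.sum_add_distrib]
      map_smul' := fun z x => by
        ext
        have hz := Subring.mem_center_iff.mp z.2
        show ∑ l, a l * ((z : A) * x * s i) * b l = (z : A) * ∑ l, a l * (x * s i) * b l
        rw [Finset.mul_sum]
        refine Finset.sum_congr rfl fun l _ => ?_
        simp only [← mul_assoc]
        rw [hz (a l)] }
  have hφ : ∀ i r, (φ i r : A) = ∑ l, a l * (r * s i) * b l := fun _ _ => rfl
  have hdual : ∀ r, ∑ i, φ i r • t i = r := hr
  have hfin : Module.Finite (Subring.center A) A := by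
    refine ⟨⟨Finset.univ.image t, ?_⟩⟩
    rw [eq_top_iff]
    intro r _
    rw [← hdual r]
    exact Submodule.sum_mem _ fun i _ =>
      Submodule.smul_mem _ _ (Submodule.subset_span (by simp))
  refine ⟨hfin, ?_, ?_, ?_⟩
  · refine Module.Projective.of_split (M := ι → Subring.center A) (LinearMap.pi φ)
      (Fintype.linearCombination (Subring.center A) t) ?_
    ext r
    simpa [Fintype.linearCombination_apply] using hdual r
  · rw [injective_iff_map_eq_zero]
    intro x hx
    obtain ⟨S, rfl⟩ := TensorProduct.exists_finset x
    have hx' : ∀ r, ∑ m ∈ S, m.1 * r * m.2.unop = 0 := fun r => by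
      have := LinearMap.congr_fun hx r
      simpa [map_sum, azumayaMulMap_tmul_apply] using this
    have hexp : ∀ m : A × Aᵐᵒᵖ, m.1 ⊗ₜ[Subring.center A] m.2 =
        ∑ i, t i ⊗ₜ[Subring.center A] (φ i m.1 • m.2) := fun m => by
      conv_lhs => rw [← hdual m.1, TensorProduct.sum_tmul]
      simp only [TensorProduct.smul_tmul]
    simp only [hexp]
    rw [Finset.sum_comm]
    refine Finset.sum_eq_zero fun i _ => ?_
    rw [← TensorProduct.tmul_sum]
    suffices h : ∑ m ∈ S, φ i m.1 • m.2 = 0 by rw [h, TensorProduct.tmul_zero]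
    apply MulOpposite.unop_injective
    rw [Finset.unop_sum, MulOpposite.unop_zero]
    calc ∑ m ∈ S, (φ i m.1 • m.2).unop
        = ∑ m ∈ S, ∑ l, a l * (m.1 * (s i * b l) * m.2.unop) := by
          refine Finset.sum_congr rfl fun m _ => ?_
          show (φ i m.1 : A) * m.2.unop = _
          rw [hφ, Finset.sum_mul]
          simp only [mul_assoc]
      _ = 0 := by
          rw [Finset.sum_comm]
          refine Finset.sum_eq_zero fun l _ => ?_
          rw [← Finset.mul_sum, hx', mul_zero]
  · intro F
    refine ⟨∑ i, ∑ l, (F (t i) * a l) ⊗ₜ MulOpposite.op (s i * b l), ?_⟩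
    ext r
    conv_rhs => rw [← hdual r, map_sum]
    simp only [map_sum, LinearMap.sum_apply, azumayaMulMap_tmul_apply, map_smul]
    refine Finset.sum_congr rfl fun i _ => ?_
    show _ = (φ i r : A) * F (t i)
    rw [← Subring.mem_center_iff.mp (φ i r).2, hφ, Finset.mul_sum]
    simp only [MulOpposite.unop_op, mul_assoc]

/-- Lagrange interpolation at a point which differs by units from all other points. -/
theorem exists_sum_mul_pow_eq_ite {R G : Type*} [CommRing R] [Group G] [Fintype G]
    [DecidableEq G] (d : G → R) (hd : ∀ σ, σ ≠ 1 → IsUnit (d 1 - d σ)) :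
    ∃ (N : ℕ) (x : Fin N → R), ∀ τ, ∑ i, x i * d τ ^ (i : ℕ) = if τ = 1 then 1 else 0 := by
  classical
  let Q : Polynomial R := ∏ σ ∈ Finset.univ.erase (1 : G), (Polynomial.X - Polynomial.C (d σ))
  have hQ : ∀ r, Q.eval r = ∏ σ ∈ Finset.univ.erase (1 : G), (r - d σ) := fun r => by
    simp [Q, Polynomial.eval_prod]
  have hu : IsUnit (Q.eval (d 1)) := by
    rw [hQ, IsUnit.prod_iff]
    exact fun σ hσ => hd σ (Finset.ne_of_mem_erase hσ)
  obtain ⟨w, hw⟩ := hu.exists_left_inv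
  refine ⟨Q.natDegree + 1, fun i => w * Q.coeff i, fun τ => ?_⟩
  simp only [mul_assoc]
  rw [← Finset.mul_sum, Fin.sum_univ_eq_sum_range (fun i => Q.coeff i * d τ ^ i),
    ← Polynomial.eval_eq_sum_range]
  split_ifs with h
  · rw [h, hw]
  · rw [hQ, Finset.prod_eq_zero (Finset.mem_erase.mpr ⟨h, Finset.mem_univ τ⟩) (sub_self _),
      mul_zero]

theorem smul_mem_center {A G : Type*} [Ring A] [Group G] [MulSemiringAction G A] (σ : G) {c : A}
    (hc : c ∈ Subring.center A) : σ • c ∈ Subring.center A := by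
  rw [Subring.mem_center_iff] at hc ⊢
  intro r
  have := congrArg (σ • ·) (hc (σ⁻¹ • r))
  simpa [smul_mul'] using this

theorem isUnit_center_of_isUnit {A : Type*} [Ring A] {c : A} (hc : c ∈ Subring.center A)
    (hu : IsUnit c) : IsUnit (⟨c, hc⟩ : Subring.center A) := by
  obtain ⟨w, rfl⟩ := hu
  have hw : (↑w⁻¹ : A) ∈ Subring.center A := by
    rw [Subring.mem_center_iff] at hc ⊢
    exact fun r => (Commute.units_inv_right (hc r)).eq
  exact IsUnit.of_mul_eq_one ⟨_, hw⟩ (by ext; simp)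

/-- Galois coordinates in the centre for an action which moves a central element by units. -/
theorem exists_galois_coordinates {A G : Type*} [Ring A] [Group G] [Fintype G] [DecidableEq G]
    [MulSemiringAction G A] {d : A} (hd : d ∈ Subring.center A)
    (hu : ∀ σ : G, σ ≠ 1 → IsUnit (d - σ • d)) :
    ∃ (N : ℕ) (x y : Fin N → A), (∀ i, x i ∈ Subring.center A) ∧ (∀ i, y i ∈ Subring.center A) ∧
      ∀ τ : G, ∑ i, x i * τ • y i = if τ = 1 then 1 else 0 := by
  obtain ⟨N, x, hx⟩ := exists_sum_mul_pow_eq_ite (R := Subring.center A) (G := G)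
    (fun σ => ⟨σ • d, smul_mem_center σ hd⟩) (fun σ hσ => by
      refine isUnit_center_of_isUnit (c := (1 : G) • d - σ • d) (Subring.sub_mem _ ?_ ?_) ?_
      · exact smul_mem_center 1 hd
      · exact smul_mem_center σ hd
      · simpa using hu σ hσ)
  refine ⟨N, fun i => x i, fun i => d ^ (i : ℕ), fun i => (x i).2,
    fun i => Subring.pow_mem _ hd _, fun τ => ?_⟩
  have := congrArg (Subring.center A).subtype (hx τ)
  simpa [map_sum, smul_pow', apply_ite] using this

theorem IsSkewGroupRing.induction_on {A G T : Type*} [Ring A] [Group G] [Fintype G]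
    [MulSemiringAction G A] [Ring T] {ι : A →+* T} {j : G → T} (hT : IsSkewGroupRing A G T ι j)
    {p : T → Prop} (t : T) (hzero : p 0) (hadd : ∀ x y, p x → p y → p (x + y))
    (hsingle : ∀ c g, p (ι c * j g)) : p t := by
  obtain ⟨c, rfl, -⟩ := hT.basis t
  exact Finset.sum_induction _ p (fun _ _ => hadd _ _) hzero fun g _ => hsingle _ _

/-- The skew group ring inherits a central trace when the group moves some central element by
units. -/
theorem IsSkewGroupRing.hasCentralTrace {A : Type*} {G : Type} {T : Type*} [Ring A] [Group G]
    [Fintype G] [MulSemiringAction G A] [Ring T] {ι : A →+* T} {j : G → T}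
    (hT : IsSkewGroupRing A G T ι j) (hA : HasCentralTrace A) {d : A}
    (hd : d ∈ Subring.center A) (hu : ∀ σ : G, σ ≠ 1 → IsUnit (d - σ • d)) :
    HasCentralTrace T := by
  classical
  obtain ⟨κ, I, _, _, a, b, s, t, hc, hr⟩ := hA
  obtain ⟨N, x, y, hx, hy, hxy⟩ := exists_galois_coordinates hd hu
  have hj : ∀ σ (c : A), j σ * ι c * j σ⁻¹ = ι (σ • c) := fun σ c => by
    rw [hT.comm, mul_assoc, hT.j_mul, mul_inv_cancel, hT.j_one, mul_one]
  let φ₀ : A → A := fun r => ∑ l, a l * r * b l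
  let φ : T → T := fun r => ∑ q : G × κ × Fin N,
    (j q.1 * ι (a q.2.1) * ι (x q.2.2)) * r * (ι (y q.2.2) * ι (b q.2.1) * j q.1⁻¹)
  have φ_zero : φ 0 = 0 := by simp [φ]
  have φ_add : ∀ r r', φ (r + r') = φ r + φ r' := fun r r' => by
    simp only [φ, mul_add, add_mul, Finset.sum_add_distrib]
  have hproj : ∀ c τ, ∑ i, ι (x i) * (ι c * j τ) * ι (y i) = if τ = 1 then ι c else 0 := by
    intro c τ
    have h1 : ∀ i, ι (x i) * (ι c * j τ) * ι (y i) = ι (c * (x i * τ • y i)) * j τ := fun i => by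
      rw [← mul_assoc, mul_assoc, hT.comm, ← mul_assoc c,
        Subring.mem_center_iff.mp (hx i) c]
      simp only [map_mul, mul_assoc]
    simp only [h1]
    rw [← Finset.sum_mul, ← map_sum, ← Finset.mul_sum, hxy]
    split_ifs with h
    · rw [h, hT.j_one, mul_one, mul_one]
    · simp
  have φ_single : ∀ c τ, φ (ι c * j τ) = if τ = 1 then ι (∑ σ : G, σ • φ₀ c) else 0 := by
    intro c τ
    have h1 : φ (ι c * j τ) = ∑ σ, j σ * (∑ l, ι (a l) *
        (∑ i, ι (x i) * (ι c * j τ) * ι (y i)) * ι (b l)) * j σ⁻¹ := by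
      simp only [φ, Fintype.sum_prod_type, Finset.mul_sum, Finset.sum_mul, mul_assoc]
    rw [h1, hproj]
    split_ifs with h
    · simp only [← map_mul, ← map_sum, hj, φ₀]
    · simp
  have φ_central : ∀ r, φ r ∈ Subring.center T := by
    intro r
    refine hT.induction_on (p := fun r => φ r ∈ Subring.center T) r ?_ ?_ ?_
    · rw [φ_zero]; exact Subring.zero_mem _
    · intro r r' h h'
      rw [φ_add]; exact Subring.add_mem _ h h'
    · intro c τ
      rw [φ_single]
      split_ifs
      · rw [Subring.mem_center_iff]
        have h0 : ∑ σ : G, σ • φ₀ c ∈ Subring.center A :=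
          Subring.sum_mem _ fun σ _ => smul_mem_center σ (hc c)
        have h2 : ∀ ρ : G, ρ • ∑ σ : G, σ • φ₀ c = ∑ σ : G, σ • φ₀ c := fun ρ => by
          rw [Finset.smul_sum]
          simp only [smul_smul]
          exact Fintype.sum_equiv (Equiv.mulLeft ρ) _ _ fun _ => rfl
        intro r
        refine hT.induction_on (p := fun r => r * _ = _ * r) r (by simp) ?_ ?_
        · intro r r' h h'
          rw [add_mul, mul_add, h, h']
        · intro c' ρ
          rw [mul_assoc, hT.comm, h2, ← mul_assoc, ← map_mul, Subring.mem_center_iff.mp h0,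
            map_mul, mul_assoc]
      · exact Subring.zero_mem _
  have φ₀_mul : ∀ r i, φ₀ (r * y i) = φ₀ r * y i := fun r i => by
    simp only [φ₀, Finset.sum_mul]
    refine Finset.sum_congr rfl fun l _ => ?_
    rw [mul_assoc (a l * r), Subring.mem_center_iff.mp (hy i) (b l)]
    simp only [mul_assoc]
  have hrec : ∀ c : A, ∑ p, ∑ i, (∑ σ : G, σ • φ₀ (c * s p * y i)) * (x i * t p) = c := by
    intro c
    conv_rhs => rw [← hr c]
    refine Finset.sum_congr rfl fun p _ => ?_
    have h1 : ∀ i, (∑ σ : G, σ • φ₀ (c * s p * y i)) * (x i * t p) =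
        ∑ σ : G, (σ • φ₀ (c * s p)) * (x i * σ • y i) * t p := fun i => by
      rw [Finset.sum_mul]
      refine Finset.sum_congr rfl fun σ _ => ?_
      rw [φ₀_mul, smul_mul', ← Subring.mem_center_iff.mp (hx i) (σ • y i)]
      simp only [mul_assoc]
    simp only [h1]
    rw [Finset.sum_comm]
    simp only [← Finset.sum_mul, ← Finset.mul_sum, hxy]
    simp [φ₀]
  refine ⟨G × κ × Fin N, G × I × Fin N, inferInstance, inferInstance,
    fun q => j q.1 * ι (a q.2.1) * ι (x q.2.2), fun q => ι (y q.2.2) * ι (b q.2.1) * j q.1⁻¹,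
    fun q => j q.1⁻¹ * ι (s q.2.1) * ι (y q.2.2), fun q => ι (x q.2.2) * ι (t q.2.1) * j q.1,
    φ_central, fun r => ?_⟩
  change ∑ q : G × I × Fin N, φ (r * (j q.1⁻¹ * ι (s q.2.1) * ι (y q.2.2))) *
    (ι (x q.2.2) * ι (t q.2.1) * j q.1) = r
  refine hT.induction_on (p := fun r => ∑ q : G × I × Fin N,
    φ (r * (j q.1⁻¹ * ι (s q.2.1) * ι (y q.2.2))) *
    (ι (x q.2.2) * ι (t q.2.1) * j q.1) = r) r ?_ ?_ ?_
  · simp [φ_zero]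
  · intro r r' h h'
    simp only [add_mul, φ_add, Finset.sum_add_distrib]
    rw [h, h']
  · intro c τ
    have h1 : ∀ σ p i, ι c * j τ * (j σ⁻¹ * ι (s p) * ι (y i)) =
        ι (c * (τ * σ⁻¹) • (s p * y i)) * j (τ * σ⁻¹) := fun σ p i => by
      rw [mul_assoc (j σ⁻¹), ← map_mul, mul_assoc (ι c), ← mul_assoc (j τ), hT.j_mul, hT.comm,
        ← mul_assoc, ← map_mul]
    simp only [Fintype.sum_prod_type, h1, φ_single]
    rw [Finset.sum_eq_single τ]
    · simp only [mul_inv_cancel, if_true, one_smul, ← map_mul, ← mul_assoc]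
      simp only [← Finset.sum_mul, ← map_sum]
      congr 2
      conv_rhs => rw [← hrec c]
      simp only [Finset.sum_mul, mul_assoc]
    · intro σ _ hσ
      have : τ * σ⁻¹ ≠ 1 := fun h => hσ (mul_inv_eq_one.mp h).symm
      simp [this]
    · simp

/-- A ring containing two anticommuting units with central squares, whose centre is their common
centralizer, has a central trace as soon as `4` is invertible. -/
theorem hasCentralTrace_of_anticommute {A : Type*} [Ring A] (U V : Aˣ)
    (hVU : (V : A) * U = -(U * V)) (hU : (U : A) ^ 2 ∈ Subring.center A)
    (hV : (V : A) ^ 2 ∈ Subring.center A)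
    (hcent : ∀ a, Commute a (U : A) → Commute a (V : A) → a ∈ Subring.center A)
    (e : A) (he : e ∈ Subring.center A) (he4 : 4 * e = 1) : HasCentralTrace A := by
  have h₁ : (V : A) * ↑U⁻¹ = -(↑U⁻¹ * V) := by
    rw [Units.mul_inv_eq_iff_eq_mul, neg_mul, mul_assoc, hVU]
    simp
  have h₂ : (↑V⁻¹ : A) * U = -(U * ↑V⁻¹) := by
    rw [Units.inv_mul_eq_iff_eq_mul, mul_neg, ← mul_assoc, hVU]
    simp
  have h₃ : (↑V⁻¹ : A) * ↑U⁻¹ = -(↑U⁻¹ * ↑V⁻¹) := by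
    rw [Units.inv_mul_eq_iff_eq_mul, mul_neg, ← mul_assoc, h₁]
    simp
  have h₀' : ∀ z, (V : A) * (U * z) = -(U * (V * z)) := fun z => by
    rw [← mul_assoc, hVU, neg_mul, mul_assoc]
  have h₂' : ∀ z, (↑V⁻¹ : A) * (U * z) = -(U * (↑V⁻¹ * z)) := fun z => by
    rw [← mul_assoc, h₂, neg_mul, mul_assoc]
  have h₃' : ∀ z, (↑V⁻¹ : A) * (↑U⁻¹ * z) = -(↑U⁻¹ * (↑V⁻¹ * z)) := fun z => by
    rw [← mul_assoc, h₃, neg_mul, mul_assoc]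
  have hsq : ∀ W : Aˣ, (W : A) ^ 2 ∈ Subring.center A →
      ∀ z, (W : A) * (W * (z * ↑W⁻¹)) = z * W := fun W hW z => by
    rw [← mul_assoc, ← mul_assoc, Units.mul_inv_eq_iff_eq_mul, ← pow_two,
      ← Subring.mem_center_iff.mp hW z, pow_two, mul_assoc]
  refine ⟨Fin 4, Fin 4, inferInstance, inferInstance, fun l => e * ![1, U, V, U * V] l,
    ![1, ↑U⁻¹, ↑V⁻¹, ↑V⁻¹ * ↑U⁻¹], ![1, ↑U⁻¹, ↑V⁻¹, ↑V⁻¹ * ↑U⁻¹], ![1, U, V, U * V],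
    fun r => ?_, fun r => ?_⟩
  · simp only [mul_assoc, ← Finset.mul_sum]
    refine Subring.mul_mem _ he (hcent _ ?_ ?_)
    · have k₁ := hsq U hU r
      have k₂ := hsq U hU (V * (r * ↑V⁻¹))
      rw [commute_iff_eq]
      simp only [mul_assoc] at k₁ k₂
      simp [Fin.sum_univ_four, mul_add, add_mul, mul_assoc, k₁, k₂]
      abel
    · have k₁ := hsq V hV r
      have k₂ := hsq V hV (r * ↑U⁻¹)
      rw [commute_iff_eq]
      simp only [mul_assoc] at k₁ k₂
      simp [Fin.sum_univ_four, mul_add, add_mul, mul_assoc, h₃, h₀', k₁, k₂]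
      abel
  · have h4 : e * r + e * r + e * r + e * r = r := by
      calc e * r + e * r + e * r + e * r = 4 * e * r := by noncomm_ring
        _ = r := by rw [he4, one_mul]
    conv_rhs => rw [← h4]
    simp [Fin.sum_univ_four, add_mul, mul_assoc, h₂, h₃, h₂', h₃']
    abel

/-- In an Ore localization, an element commuting with the image of the original ring is central. -/
theorem IsOreLocalization.map_mem_center {A B : Type*} [Ring A] [Ring B] {S : Submonoid A}
    {f : A →+* B} (hf : IsOreLocalization S f) {b : B} (hb : ∀ a, Commute (f a) b) :
    b ∈ Subring.center B := by
  rw [Subring.mem_center_iff]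
  intro r
  obtain ⟨a, s, hs, h⟩ := hf.num_den r
  apply (hf.isUnit s hs).mul_right_cancel
  rw [mul_assoc, ← (hb s).eq, ← mul_assoc, h, (hb a).eq, mul_assoc, h]

theorem isUnit_of_mul_eq_of_mul_eq {M : Type*} [Monoid M] {a b c w : M} (hw : IsUnit w)
    (hb : b * a = w) (hc : a * c = w) : IsUnit a := by
  obtain ⟨w, rfl⟩ := hw
  exact isUnit_iff_exists_and_exists.mpr
    ⟨⟨c * ↑w⁻¹, by rw [← mul_assoc, hc, Units.mul_inv]⟩,
      ⟨↑w⁻¹ * b, by rw [mul_assoc, hb, Units.inv_mul]⟩⟩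

theorem qV_mul_qU (K : Type*) [CommRing K] (q : K) : qV K q * qU K q = q • (qU K q * qV K q) := by
  simpa [qU, qV] using RingQuot.mkAlgHom_rel K (QuantumRel.rel (K := K) (q := q))

theorem QuantumPlane.subalgebra_eq_top {K : Type*} [CommRing K] {q : K}
    {S : Subalgebra K (QuantumPlane K q)} (hu : qU K q ∈ S) (hv : qV K q ∈ S) : S = ⊤ := by
  have h : S.comap (RingQuot.mkAlgHom K (QuantumRel K q)) = ⊤ := by
    rw [eq_top_iff, ← FreeAlgebra.adjoin_range_ι, Algebra.adjoin_le_iff]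
    rintro _ ⟨i, rfl⟩
    fin_cases i
    exacts [hu, hv]
  rw [eq_top_iff]
  intro x _
  obtain ⟨y, rfl⟩ := RingQuot.mkAlgHom_surjective K (QuantumRel K q) x
  have : y ∈ S.comap (RingQuot.mkAlgHom K (QuantumRel K q)) := h ▸ Algebra.mem_top
  exact this

/-- Elements commuting with the images of the scalars and of both generators commute with the image
of the quantum plane. -/
theorem QuantumPlane.commute_map {K B : Type*} [CommRing K] {q : K} [Ring B]
    (f : QuantumPlane K q →+* B) {b : B} (hK : ∀ c : K, Commute (f (algebraMap K _ c)) b)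
    (hu : Commute (f (qU K q)) b) (hv : Commute (f (qV K q)) b) (a : QuantumPlane K q) :
    Commute (f a) b := by
  let S : Subalgebra K (QuantumPlane K q) :=
    { carrier := {a | Commute (f a) b}
      mul_mem' := fun {x y} hx hy => by
        show Commute (f (x * y)) b
        rw [map_mul]; exact Commute.mul_left hx hy
      add_mem' := fun {x y} hx hy => by
        show Commute (f (x + y)) b
        rw [map_add]; exact Commute.add_left hx hy
      algebraMap_mem' := hK }
  have : a ∈ S := (QuantumPlane.subalgebra_eq_top (S := S) hu hv) ▸ Algebra.mem_top
  exact this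

/-- For odd `n`, the skew group ring `k_{-1}[u^{±1},v^{±1}][(u^{2n}-v^{2n})⁻¹] # D_n`
is Azumaya. -/
theorem localizedMinusOnePlane_Dn_odd_skewGroupRing_azumaya
    (k : Type) [Field k] [IsAlgClosed k] [CharZero k]
    (n : ℕ) (hn : 0 < n) (hodd : Odd n) (ω : k) (hω : IsPrimitiveRoot ω n)
    (G : Type) [Group G] [Fintype G] (g h : G)
    (hordg : orderOf g = n) (hordh : orderOf h = 2) (hrel : h * g * h = g⁻¹)
    (hcard : Fintype.card G = 2 * n)
    (hgen : ∀ x : G, ∃ i : ℕ, x = g ^ i ∨ x = g ^ i * h)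
    [MulSemiringAction G (QuantumPlane k (-1 : k))]
    [SMulCommClass G k (QuantumPlane k (-1 : k))]
    (hgu : g • qU k (-1 : k) = ω • qU k (-1 : k))
    (hgv : g • qV k (-1 : k) = ω⁻¹ • qV k (-1 : k))
    (hhu : h • qU k (-1 : k) = qV k (-1 : k)) (hhv : h • qV k (-1 : k) = qU k (-1 : k))
    (A'' : Type) [Ring A''] (f : QuantumPlane k (-1 : k) →+* A'')
    (hloc : IsOreLocalization
      (Submonoid.closure
        {qU k (-1 : k), qV k (-1 : k),
          qU k (-1 : k) ^ (2 * n) - qV k (-1 : k) ^ (2 * n)}) f)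
    [MulSemiringAction G A'']
    (hequi : ∀ (x : G) (a : QuantumPlane k (-1 : k)), x • f a = f (x • a))
    (T'' : Type) [Ring T''] (iota : A'' →+* T'') (j : G → T'')
    (hT : IsSkewGroupRing A'' G T'' iota j) :
    IsAzumayaAlgebra T'' := by
  set u := qU k (-1 : k)
  set v := qV k (-1 : k)
  have hvu : v * u = -(u * v) := by
    exact (qV_mul_qU k (-1 : k)).trans (neg_one_smul k (u * v))
  have hanti : f v * f u = -(f u * f v) := by rw [← map_mul, hvu, map_neg, map_mul]
  have hscalar : ∀ c : k, f (algebraMap k _ c) ∈ Subring.center A'' := fun c =>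
    hloc.map_mem_center fun a => by
      rw [commute_iff_eq, ← map_mul, ← map_mul, (Algebra.commutes c a).symm]
  have hcent : ∀ b, Commute b (f u) → Commute b (f v) → b ∈ Subring.center A'' :=
    fun b hbu hbv => hloc.map_mem_center <| QuantumPlane.commute_map f
      (fun c => (Subring.mem_center_iff.mp (hscalar c) b).symm) hbu.symm hbv.symm
  have hu2 : f u ^ 2 ∈ Subring.center A'' := by
    refine hcent _ ((Commute.refl _).pow_left 2) ?_
    rw [commute_iff_eq, pow_two, mul_assoc, ← mul_assoc (f v), hanti, neg_mul, mul_assoc, hanti]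
    simp
  have hv2 : f v ^ 2 ∈ Subring.center A'' := by
    refine hcent _ ?_ ((Commute.refl _).pow_left 2)
    rw [commute_iff_eq, pow_two, mul_assoc, hanti, mul_neg, ← mul_assoc, hanti]
    simp [mul_assoc]
  obtain ⟨U, hU⟩ : IsUnit (f u) := hloc.isUnit _ (Submonoid.subset_closure (by simp))
  obtain ⟨V, hV⟩ : IsUnit (f v) := hloc.isUnit _ (Submonoid.subset_closure (by simp))
  have hdelta : IsUnit ((f u ^ 2) ^ n - (f v ^ 2) ^ n) := by
    have := hloc.isUnit (u ^ (2 * n) - v ^ (2 * n)) (Submonoid.subset_closure (by simp))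
    simpa [pow_mul] using this
  have htrace : HasCentralTrace A'' := by
    refine hasCentralTrace_of_anticommute U V ?_ ?_ ?_ ?_ _ (hscalar 4⁻¹) ?_
    · rwa [hU, hV]
    · rwa [hU]
    · rwa [hV]
    · rwa [hU, hV]
    · have h4 : (4 : A'') = f (algebraMap k _ 4) :=
        (map_ofNat (f.comp (algebraMap k (QuantumPlane k (-1 : k)))) 4).symm
      have h4' : (4 : k) ≠ 0 := by norm_num
      rw [h4, ← map_mul, ← map_mul, mul_inv_cancel₀ h4', map_one, map_one]
  have hsmul : ∀ (x : G) (c : k) (a : QuantumPlane k (-1 : k)), x • c • a = c • x • a :=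
    fun x c a => smul_comm x c a
  have hgpow : ∀ i : ℕ, g ^ i • u = ω ^ i • u := by
    intro i
    induction i with
    | zero => simp
    | succ i ih => rw [pow_succ, mul_smul, hgu, hsmul, ih, smul_smul, pow_succ']
  have hgpow' : ∀ i : ℕ, g ^ i • v = (ω⁻¹) ^ i • v := by
    intro i
    induction i with
    | zero => simp
    | succ i ih => rw [pow_succ, mul_smul, hgv, hsmul, ih, smul_smul, pow_succ']
  have hfsmul : ∀ (c : k) a, f (c • a) = f (algebraMap k _ c) * f a := fun c a => by
    rw [Algebra.smul_def, map_mul]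
  refine (hT.hasCentralTrace htrace hu2 fun σ hσ => ?_).isAzumayaAlgebra
  rw [smul_pow', hequi]
  obtain ⟨i, rfl | rfl⟩ := hgen σ
  · have hω2 : (1 : k) - (ω ^ i) ^ 2 ≠ 0 := by
      intro h0
      have h1 : ω ^ (i * 2) = 1 := by rw [pow_mul]; exact (sub_eq_zero.mp h0).symm
      have h2 : n ∣ i := (Nat.Coprime.dvd_of_dvd_mul_right
        (Nat.coprime_two_right.mpr hodd)) (hω.dvd_of_pow_eq_one _ h1)
      exact hσ (orderOf_dvd_iff_pow_eq_one.mp (hordg ▸ h2))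
    have : f u ^ 2 - f (g ^ i • u) ^ 2 = f (algebraMap k _ (1 - (ω ^ i) ^ 2)) * f u ^ 2 := by
      rw [hgpow, ← map_pow, ← map_pow, smul_pow, hfsmul]
      simp [sub_mul]
    rw [this]
    exact (((IsUnit.mk0 _ hω2).map (algebraMap k (QuantumPlane k (-1 : k)))).map f).mul
      ((hU ▸ U.isUnit).pow 2)
  · have h1 : f ((g ^ i * h) • u) ^ 2 = f (algebraMap k _ (((ω⁻¹) ^ i) ^ 2)) * f v ^ 2 := by
      rw [mul_smul, hhu, hgpow', ← map_pow, ← map_pow, smul_pow, hfsmul]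
    have hcomm : Commute (f u ^ 2) (f ((g ^ i * h) • u) ^ 2) :=
      (Subring.mem_center_iff.mp hu2 _).symm
    have hpow : (f ((g ^ i * h) • u) ^ 2) ^ n = (f v ^ 2) ^ n := by
      rw [h1, (show Commute _ _ from Subring.mem_center_iff.mp hv2 _).mul_pow, ← map_pow,
        ← map_pow, pow_right_comm (ω⁻¹ ^ i), pow_right_comm ω⁻¹, inv_pow, hω.pow_eq_one]
      simp
    have hgeom := hcomm.geom_sum₂_mul n
    have hgeom' := hcomm.mul_geom_sum₂ n
    rw [hpow] at hgeom hgeom'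
    exact isUnit_of_mul_eq_of_mul_eq hdelta hgeom hgeom'
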